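/- Let χ₁ and χ₂ be quadratic Dirichlet characters modulo q₁ and q₂ respectively, and for each positive integer n define a_n = Σ_{k·l·m·r = n} χ₁(l) · χ₂(m) · (χ₁χ₂)(r), the n-th Dirichlet series coefficient of ζ(s)L(s, χ₁)L(s, χ₂)L(s, χ₁χ₂). Then a_n ≥ 0 for every n ≥ 1, and a_1 = 1. -/

import Mathlib

open DirichletCharacter

/-- The `n`-th Dirichlet series coefficient of `ζ(s) L(s,χ₁) L(s,χ₂) L(s,χ₁χ₂)`:
`a n = Σ_{k·l·m·r = n} χ₁(l) χ₂(m) (χ₁χ₂)(r)`, the sum ranging over all ordered quadruples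
`(k,l,m,r)` of positive integers with `k·l·m·r = n`. -/
noncomputable def siegelCoeff (q₁ q₂ : ℕ)
    (χ₁ : DirichletCharacter ℂ q₁) (χ₂ : DirichletCharacter ℂ q₂) (n : ℕ) : ℂ :=
  ∑ p ∈ (Finset.Icc 1 n ×ˢ Finset.Icc 1 n ×ˢ Finset.Icc 1 n ×ˢ Finset.Icc 1 n).filter
      (fun p : ℕ × ℕ × ℕ × ℕ => p.1 * p.2.1 * p.2.2.1 * p.2.2.2 = n),
    χ₁ (p.2.1 : ZMod q₁) * χ₂ (p.2.2.1 : ZMod q₂) *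
      (changeLevel (dvd_mul_right q₁ q₂) χ₁ * changeLevel (dvd_mul_left q₂ q₁) χ₂)
        (p.2.2.2 : ZMod (q₁ * q₂))

section

open ArithmeticFunction
open scoped ComplexOrder

variable {q₁ q₂ : ℕ}

/-- The product of characters of levels `q₁` and `q₂`, lifted to level `q₁ * q₂`, is the pointwise
product on natural numbers. -/
lemma changeLevel_mul_changeLevel_natCast (χ₁ : DirichletCharacter ℂ q₁)
    (χ₂ : DirichletCharacter ℂ q₂) (r : ℕ) :
    (changeLevel (dvd_mul_right q₁ q₂) χ₁ * changeLevel (dvd_mul_left q₂ q₁) χ₂)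
      (r : ZMod (q₁ * q₂)) = χ₁ r * χ₂ r := by
  by_cases hr : IsUnit (r : ZMod (q₁ * q₂))
  · obtain ⟨u, hu⟩ := hr
    rw [MulChar.mul_apply, ← hu, changeLevel_eq_cast_of_dvd, changeLevel_eq_cast_of_dvd, hu,
      ZMod.cast_natCast (dvd_mul_right q₁ q₂), ZMod.cast_natCast (dvd_mul_left q₂ q₁)]
  · rw [MulChar.map_nonunit _ hr]
    rw [ZMod.isUnit_iff_coprime, Nat.coprime_mul_iff_right, not_and_or,
      ← ZMod.isUnit_iff_coprime, ← ZMod.isUnit_iff_coprime] at hr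
    rcases hr with h | h <;> simp [MulChar.map_nonunit _ h]

/-- The fourfold Dirichlet convolution as a sum over quadruples with given product. -/
lemma ArithmeticFunction.mul_mul_mul_apply {R : Type*} [Semiring R]
    (f g h k : ArithmeticFunction R) (n : ℕ) :
    (f * (g * (h * k))) n =
      ∑ p ∈ (Finset.Icc 1 n ×ˢ Finset.Icc 1 n ×ˢ Finset.Icc 1 n ×ˢ Finset.Icc 1 n).filter
        (fun p : ℕ × ℕ × ℕ × ℕ => p.1 * p.2.1 * p.2.2.1 * p.2.2.2 = n),
        f p.1 * (g p.2.1 * (h p.2.2.1 * k p.2.2.2)) := by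
  simp only [mul_apply, Finset.mul_sum, Finset.sum_sigma']
  refine Finset.sum_nbij' (fun x ↦ (x.1.1, x.2.1.1, x.2.2.1, x.2.2.2))
    (fun p ↦ ⟨(p.1, p.2.1 * (p.2.2.1 * p.2.2.2)), (p.2.1, p.2.2.1 * p.2.2.2),
      (p.2.2.1, p.2.2.2)⟩) ?_ ?_ ?_ ?_ ?_
  · rintro ⟨x, y, z⟩ hx
    simp only [Finset.mem_sigma, Nat.mem_divisorsAntidiagonal] at hx
    obtain ⟨⟨hx, hn⟩, ⟨hy, -⟩, hz, -⟩ := hx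
    have h : x.1 * y.1 * z.1 * z.2 = n := by rw [← hx, ← hy, ← hz]; ring
    have hn0 := Nat.pos_of_ne_zero hn
    have hle {d : ℕ} (hd : d ∣ n) : 1 ≤ d ∧ d ≤ n :=
      ⟨Nat.pos_of_dvd_of_pos hd hn0, Nat.le_of_dvd hn0 hd⟩
    simp only [Finset.mem_filter, Finset.mem_product, Finset.mem_Icc]
    exact ⟨⟨hle ⟨y.1 * z.1 * z.2, by rw [← h]; ring⟩, hle ⟨x.1 * z.1 * z.2, by rw [← h]; ring⟩,
      hle ⟨x.1 * y.1 * z.2, by rw [← h]; ring⟩, hle ⟨x.1 * y.1 * z.1, by rw [← h]; ring⟩⟩, h⟩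
  · rintro ⟨a, b, c, d⟩ hp
    simp only [Finset.mem_filter, Finset.mem_product, Finset.mem_Icc] at hp
    obtain ⟨⟨⟨ha, -⟩, ⟨hb, -⟩, ⟨hc, -⟩, ⟨hd, -⟩⟩, rfl⟩ := hp
    simp [mul_assoc, Nat.ne_of_gt ha, Nat.ne_of_gt hb, Nat.ne_of_gt hc, Nat.ne_of_gt hd]
  · rintro ⟨⟨a, a'⟩, ⟨b, b'⟩, ⟨c, d⟩⟩ hx
    simp only [Finset.mem_sigma, Nat.mem_divisorsAntidiagonal] at hx
    obtain ⟨-, ⟨rfl, -⟩, rfl, -⟩ := hx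
    rfl
  · intro p _
    rfl
  · intro x _
    rfl

/-- Multiplying `zetaMul χ₁` pointwise by `χ₂` gives the convolution of `χ₂` and `χ₁χ₂`. -/
lemma pmul_zetaMul (χ₁ : DirichletCharacter ℂ q₁) (χ₂ : DirichletCharacter ℂ q₂) :
    pmul (toArithmeticFunction (χ₂ ·)) χ₁.zetaMul =
      toArithmeticFunction (χ₂ ·) * toArithmeticFunction (fun n ↦ χ₁ n * χ₂ n) := by
  ext n
  rw [pmul_apply, zetaMul, mul_apply, mul_apply, Finset.mul_sum]
  refine Finset.sum_congr rfl fun x hx ↦ ?_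
  obtain ⟨rfl, hn⟩ := Nat.mem_divisorsAntidiagonal.mp hx
  obtain ⟨h1, h2⟩ := mul_ne_zero_iff.mp hn
  simp [toArithmeticFunction, h1, h2]
  ring

/-- The Dirichlet coefficients of `ζ(s) L(s,χ₁) L(s,χ₂) L(s,χ₁χ₂)`, as a convolution. -/
noncomputable def zetaMulTwist (χ₁ : DirichletCharacter ℂ q₁) (χ₂ : DirichletCharacter ℂ q₂) :
    ArithmeticFunction ℂ :=
  χ₁.zetaMul * pmul (toArithmeticFunction (χ₂ ·)) χ₁.zetaMul

lemma zetaMulTwist_comm (χ₁ : DirichletCharacter ℂ q₁) (χ₂ : DirichletCharacter ℂ q₂) :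
    zetaMulTwist χ₁ χ₂ = zetaMulTwist χ₂ χ₁ := by
  have h : (fun n : ℕ ↦ χ₂ n * χ₁ n) = fun n : ℕ ↦ χ₁ n * χ₂ n := funext fun _ ↦ mul_comm _ _
  rw [zetaMulTwist, zetaMulTwist, pmul_zetaMul, pmul_zetaMul, zetaMul, zetaMul, h]
  ring

lemma isMultiplicative_zetaMulTwist (χ₁ : DirichletCharacter ℂ q₁)
    (χ₂ : DirichletCharacter ℂ q₂) : (zetaMulTwist χ₁ χ₂).IsMultiplicative :=
  (isMultiplicative_zetaMul χ₁).mul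
    ((isMultiplicative_toArithmeticFunction χ₂).pmul (isMultiplicative_zetaMul χ₁))

lemma zetaMul_prime_pow_eq_zero_of_odd {χ : DirichletCharacter ℂ q₁} {p : ℕ} (hp : p.Prime)
    (h : χ p = -1) {j : ℕ} (hj : _root_.Odd j) : χ.zetaMul (p ^ j) = 0 := by
  rw [zetaMul, coe_zeta_mul_apply, Nat.sum_divisors_prime_pow hp]
  simp [toArithmeticFunction, hp.ne_zero, h, neg_one_geom_sum, hj.add_one]

lemma zetaMulTwist_nonneg_of_pow_mul_nonneg {χ₁ : DirichletCharacter ℂ q₁}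
    {χ₂ : DirichletCharacter ℂ q₂} (h₁ : χ₁ ^ 2 = 1) {p : ℕ} (hp : p.Prime)
    (h : ∀ j : ℕ, 0 ≤ χ₂ p ^ j * χ₁.zetaMul (p ^ j)) (k : ℕ) :
    0 ≤ zetaMulTwist χ₁ χ₂ (p ^ k) := by
  rw [zetaMulTwist, mul_apply]
  refine Finset.sum_nonneg fun x hx ↦ mul_nonneg (zetaMul_nonneg h₁ _) ?_
  obtain ⟨j, -, hj⟩ := (Nat.dvd_prime_pow hp).mp
    (Dvd.intro_left _ (Nat.mem_divisorsAntidiagonal.mp hx).1)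
  rw [hj, pmul_apply]
  simpa [toArithmeticFunction, hp.ne_zero] using h j

lemma zetaMulTwist_prime_pow_nonneg {χ₁ : DirichletCharacter ℂ q₁}
    {χ₂ : DirichletCharacter ℂ q₂} (h₁ : χ₁ ^ 2 = 1) (h₂ : χ₂ ^ 2 = 1) {p : ℕ} (hp : p.Prime)
    (k : ℕ) : 0 ≤ zetaMulTwist χ₁ χ₂ (p ^ k) := by
  rcases MulChar.isQuadratic_iff_sq_eq_one.mpr h₂ p with h | h | h
  · exact zetaMulTwist_nonneg_of_pow_mul_nonneg h₁ hp (fun j ↦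
      mul_nonneg (by rw [h]; exact pow_nonneg le_rfl j) (zetaMul_nonneg h₁ _)) k
  · exact zetaMulTwist_nonneg_of_pow_mul_nonneg h₁ hp (fun j ↦
      mul_nonneg (by simp [h]) (zetaMul_nonneg h₁ _)) k
  · rw [zetaMulTwist_comm]
    refine zetaMulTwist_nonneg_of_pow_mul_nonneg h₂ hp (fun j ↦ ?_) k
    rcases Nat.even_or_odd j with hj | hj
    · refine mul_nonneg ?_ (zetaMul_nonneg h₂ _)
      rcases MulChar.isQuadratic_iff_sq_eq_one.mpr h₁ p with h' | h' | h'
      · rw [h']; exact pow_nonneg le_rfl j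
      · simp [h']
      · simp [h', hj.neg_one_pow]
    · simp [zetaMul_prime_pow_eq_zero_of_odd hp h hj]

lemma zetaMulTwist_nonneg {χ₁ : DirichletCharacter ℂ q₁} {χ₂ : DirichletCharacter ℂ q₂}
    (h₁ : χ₁ ^ 2 = 1) (h₂ : χ₂ ^ 2 = 1) (n : ℕ) : 0 ≤ zetaMulTwist χ₁ χ₂ n := by
  rcases eq_or_ne n 0 with rfl | hn
  · simp
  · rw [(isMultiplicative_zetaMulTwist χ₁ χ₂).multiplicative_factorization _ hn]
    exact Finset.prod_nonneg fun p hp ↦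
      zetaMulTwist_prime_pow_nonneg h₁ h₂ (Nat.prime_of_mem_primeFactors hp) _

lemma siegelCoeff_eq_zetaMulTwist (χ₁ : DirichletCharacter ℂ q₁) (χ₂ : DirichletCharacter ℂ q₂)
    (n : ℕ) : siegelCoeff q₁ q₂ χ₁ χ₂ n = zetaMulTwist χ₁ χ₂ n := by
  rw [zetaMulTwist, pmul_zetaMul, zetaMul, mul_assoc, mul_mul_mul_apply, siegelCoeff]
  refine Finset.sum_congr rfl fun p hp ↦ ?_
  simp only [Finset.mem_filter, Finset.mem_product, Finset.mem_Icc] at hp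
  obtain ⟨⟨⟨h1, -⟩, ⟨h2, -⟩, ⟨h3, -⟩, ⟨h4, -⟩⟩, -⟩ := hp
  rw [changeLevel_mul_changeLevel_natCast]
  simp [toArithmeticFunction, Nat.ne_of_gt h1, Nat.ne_of_gt h2, Nat.ne_of_gt h3, Nat.ne_of_gt h4,
    mul_assoc]

end

/-- For quadratic characters `χ₁, χ₂`, the coefficients `a_n` of
`ζ(s) L(s,χ₁) L(s,χ₂) L(s,χ₁χ₂)` satisfy `a_n ≥ 0` for all `n ≥ 1`, and `a_1 = 1`. -/
theorem siegelCoeff_nonneg_and_one (q₁ q₂ : ℕ)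
    (χ₁ : DirichletCharacter ℂ q₁) (χ₂ : DirichletCharacter ℂ q₂)
    (h₁ : χ₁ ^ 2 = 1) (h₁' : χ₁ ≠ 1) (h₂ : χ₂ ^ 2 = 1) (h₂' : χ₂ ≠ 1) :
    (∀ n : ℕ, 1 ≤ n → ∃ ρ : ℝ, siegelCoeff q₁ q₂ χ₁ χ₂ n = (ρ : ℂ) ∧ 0 ≤ ρ) ∧
      siegelCoeff q₁ q₂ χ₁ χ₂ 1 = 1 := by
  simp only [siegelCoeff_eq_zetaMulTwist]
  refine ⟨fun n _ ↦ ?_, (isMultiplicative_zetaMulTwist χ₁ χ₂).map_one⟩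
  obtain ⟨hre, him⟩ := Complex.nonneg_iff.mp (zetaMulTwist_nonneg h₁ h₂ n)
  exact ⟨_, Complex.ext rfl him.symm, hre⟩
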